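/- Under the Gromov-Hausdorff-Prokhorov metric d, the set ℳ̂_* of GHP-isometry classes of boundedly compact pmm spaces is a complete separable metric space. -/

import Mathlib

open MeasureTheory Topology Filter

noncomputable section

/-- Prokhorov distance between finite Borel measures on a metric space. -/
def prokhorovDist {Z : Type*} [MetricSpace Z] [MeasurableSpace Z]
    (μ ν : Measure Z) : ℝ :=
  sInf {ε : ℝ | 0 < ε ∧ ∀ A : Set Z, IsClosed A →
    μ A ≤ ν (Metric.cthickening ε A) + ENNReal.ofReal ε ∧
    ν A ≤ μ (Metric.cthickening ε A) + ENNReal.ofReal ε}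

/-- A pointed measured metric space: a metric space with a distinguished point and a Borel
measure. -/
structure PMM : Type 1 where
  carrier : Type
  metric : MetricSpace carrier
  basepoint : carrier
  meas : @Measure carrier
    (@borel carrier metric.toPseudoMetricSpace.toUniformSpace.toTopologicalSpace)

attribute [instance] PMM.metric

instance PMM.instMeasurableSpace (𝒳 : PMM) : MeasurableSpace 𝒳.carrier := borel 𝒳.carrier

instance PMM.instBorelSpace (𝒳 : PMM) : BorelSpace 𝒳.carrier := ⟨rfl⟩

/-- A pmm space is boundedly compact if every closed ball is compact and has finite measure. -/
def PMM.BoundedlyCompact (𝒳 : PMM) : Prop :=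
  (∀ (x : 𝒳.carrier) (r : ℝ), IsCompact (Metric.closedBall x r)) ∧
  (∀ (x : 𝒳.carrier) (r : ℝ), 𝒳.meas (Metric.closedBall x r) ≠ ⊤)

/-- A pmm space is compact if its carrier is compact and its measure is finite. -/
def PMM.IsCompactPMM (𝒳 : PMM) : Prop :=
  CompactSpace 𝒳.carrier ∧ 𝒳.meas Set.univ ≠ ⊤

/-- A pair of maps of two pmm spaces into a common metric space. -/
structure GHPEmbedding (𝒳 𝒴 : PMM) : Type 1 where
  Z : Type
  mZ : MetricSpace Z
  f : 𝒳.carrier → Z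
  g : 𝒴.carrier → Z

attribute [instance] GHPEmbedding.mZ

/-- Both maps of a `GHPEmbedding` are isometric embeddings. -/
def GHPEmbedding.IsIsometric {𝒳 𝒴 : PMM} (e : GHPEmbedding 𝒳 𝒴) : Prop :=
  Isometry e.f ∧ Isometry e.g

/-- The quantity `max(d(f o_X, g o_Y), dH(f(X), g(Y)), dP(f_*μ_X, g_*μ_Y))` associated to a
pair of embeddings into a common space. -/
def GHPEmbedding.value {𝒳 𝒴 : PMM} (e : GHPEmbedding 𝒳 𝒴) : ℝ :=
  letI : MeasurableSpace e.Z := borel e.Z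
  max (dist (e.f 𝒳.basepoint) (e.g 𝒴.basepoint))
    (max (Metric.hausdorffDist (Set.range e.f) (Set.range e.g))
      (prokhorovDist (𝒳.meas.map e.f) (𝒴.meas.map e.g)))

/-- The Gromov-Hausdorff-Prokhorov distance of compact pmm spaces. -/
def cGHP (𝒳 𝒴 : PMM) : ℝ :=
  sInf {x : ℝ | ∃ e : GHPEmbedding 𝒳 𝒴, e.IsIsometric ∧ x = e.value}

/-- A pmm-subspace of a pmm space `𝒳`: a subset containing the basepoint together with a
measure `≤ 𝒳.meas` supported on the subset. -/
structure SubPMM (𝒳 : PMM) where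
  set : Set 𝒳.carrier
  root_mem : 𝒳.basepoint ∈ set
  meas : Measure 𝒳.carrier
  meas_le : meas ≤ 𝒳.meas
  supported : meas setᶜ = 0

/-- The pmm space associated to a pmm-subspace. -/
def SubPMM.toPMM {𝒳 : PMM} (S : SubPMM 𝒳) : PMM where
  carrier := ↥S.set
  metric := inferInstance
  basepoint := ⟨𝒳.basepoint, S.root_mem⟩
  meas := @Measure.comap ↥S.set 𝒳.carrier (borel ↥S.set) inferInstance Subtype.val S.meas

/-- The pmm-subspace ordering: inclusion of sets and inequality of measures. -/
instance {𝒳 : PMM} : LE (SubPMM 𝒳) :=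
  ⟨fun S T => S.set ⊆ T.set ∧ S.meas ≤ T.meas⟩

/-- Compactness of a pmm-subspace. -/
def SubPMM.IsCompactSub {𝒳 : PMM} (S : SubPMM 𝒳) : Prop :=
  IsCompact S.set ∧ S.meas Set.univ ≠ ⊤

/-- The closed ball of radius `r` around the basepoint, as a pmm-subspace (for `r ≥ 0` the
underlying set is exactly the closed ball; the basepoint is inserted so that the definition
makes sense for all `r`). -/
def PMM.ballSub (𝒳 : PMM) (r : ℝ) : SubPMM 𝒳 where
  set := insert 𝒳.basepoint (Metric.closedBall 𝒳.basepoint r)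
  root_mem := Set.mem_insert _ _
  meas := 𝒳.meas.restrict (insert 𝒳.basepoint (Metric.closedBall 𝒳.basepoint r))
  meas_le := Measure.restrict_le_self
  supported := by
    rw [Measure.restrict_apply ((measurableSet_closedBall.insert 𝒳.basepoint).compl),
      Set.compl_inter_self]
    simp

/-- The quantity `a(ε, r; 𝒳, 𝒴)`. -/
def aFun (ε r : ℝ) (𝒳 𝒴 : PMM) : ℝ :=
  sInf {x : ℝ | ∃ Y' : SubPMM 𝒴, Y'.IsCompactSub ∧ 𝒴.ballSub (r - ε) ≤ Y' ∧
    x = cGHP ((𝒳.ballSub r).toPMM) Y'.toPMM}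

/-- The quantity `a_ε(𝒳, 𝒴) = a(ε, 1/ε; 𝒳, 𝒴)`. -/
def aEps (ε : ℝ) (𝒳 𝒴 : PMM) : ℝ := aFun ε (1 / ε) 𝒳 𝒴

/-- The Gromov-Hausdorff-Prokhorov distance of boundedly compact pmm spaces
(with `inf ∅ = 1`). -/
def GHP (𝒳 𝒴 : PMM) : ℝ :=
  sInf (insert 1 {ε : ℝ | ε ∈ Set.Ioc (0 : ℝ) 1 ∧ max (aEps ε 𝒳 𝒴) (aEps ε 𝒴 𝒳) < ε / 2})

/-- Two pmm spaces are GHP-isometric if there is a root-preserving measure-preserving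
surjective isometry between them. -/
def GHPIsometric (𝒳 𝒴 : PMM) : Prop :=
  ∃ ρ : 𝒳.carrier → 𝒴.carrier, Isometry ρ ∧ Function.Surjective ρ ∧
    ρ 𝒳.basepoint = 𝒴.basepoint ∧ 𝒳.meas.map ρ = 𝒴.meas

/-- `r` is a continuity radius of a pmm space. -/
def PMM.ContinuityRadius (𝒳 : PMM) (r : ℝ) : Prop :=
  0 < r ∧ Metric.closedBall 𝒳.basepoint r = closure (Metric.ball 𝒳.basepoint r) ∧
    𝒳.meas (Metric.closedBall 𝒳.basepoint r \ Metric.ball 𝒳.basepoint r) = 0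

/-- `R` relates `𝒳` to `𝒴` up to an error `ε` on the balls of radius `r` about the roots: it relates
the roots, has distortion at most `ε`, is total on both balls, and transports the measure of
subsets of either ball up to `ε`. -/
structure PMM.IsApproxRel (𝒳 𝒴 : PMM) (r ε : ℝ) (R : 𝒳.carrier → 𝒴.carrier → Prop) : Prop where
  root : R 𝒳.basepoint 𝒴.basepoint
  distortion : ∀ ⦃x x' y y'⦄, R x y → R x' y' → |dist x x' - dist y y'| ≤ ε
  exists_right : ∀ x, dist x 𝒳.basepoint ≤ r → ∃ y, R x y
  exists_left : ∀ y, dist y 𝒴.basepoint ≤ r → ∃ x, R x y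
  meas_le_right : ∀ A ⊆ Metric.closedBall 𝒳.basepoint r,
    𝒳.meas A ≤ 𝒴.meas {y | ∃ x ∈ A, R x y} + ENNReal.ofReal ε
  meas_le_left : ∀ B ⊆ Metric.closedBall 𝒴.basepoint r,
    𝒴.meas B ≤ 𝒳.meas {x | ∃ y ∈ B, R x y} + ENNReal.ofReal ε

/-- Two pmm spaces are related up to an error `ε` on balls of radius `r`. -/
def PMM.Approx (𝒳 𝒴 : PMM) (r ε : ℝ) : Prop :=
  ∃ R, 𝒳.IsApproxRel 𝒴 r ε R

namespace PMM

variable {𝒳 𝒴 : PMM} {r r' ε ε' : ℝ} {R : 𝒳.carrier → 𝒴.carrier → Prop}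

lemma IsApproxRel.swap (h : 𝒳.IsApproxRel 𝒴 r ε R) : 𝒴.IsApproxRel 𝒳 r ε (fun y x => R x y) where
  root := h.root
  distortion _ _ _ _ h₁ h₂ := by rw [abs_sub_comm]; exact h.distortion h₁ h₂
  exists_right := h.exists_left
  exists_left := h.exists_right
  meas_le_right := h.meas_le_left
  meas_le_left := h.meas_le_right

lemma IsApproxRel.mono (h : 𝒳.IsApproxRel 𝒴 r ε R) (hr : r' ≤ r) (hε : ε ≤ ε') :
    𝒳.IsApproxRel 𝒴 r' ε' R where
  root := h.root
  distortion _ _ _ _ h₁ h₂ := (h.distortion h₁ h₂).trans hε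
  exists_right x hx := h.exists_right x (hx.trans hr)
  exists_left y hy := h.exists_left y (hy.trans hr)
  meas_le_right A hA := (h.meas_le_right A (hA.trans (Metric.closedBall_subset_closedBall hr))).trans
    (by gcongr)
  meas_le_left A hA := (h.meas_le_left A (hA.trans (Metric.closedBall_subset_closedBall hr))).trans
    (by gcongr)

lemma Approx.symm (h : 𝒳.Approx 𝒴 r ε) : 𝒴.Approx 𝒳 r ε :=
  let ⟨_, hR⟩ := h; ⟨_, hR.swap⟩

lemma Approx.mono (h : 𝒳.Approx 𝒴 r ε) (hr : r' ≤ r) (hε : ε ≤ ε') : 𝒳.Approx 𝒴 r' ε' :=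
  let ⟨R, hR⟩ := h; ⟨R, hR.mono hr hε⟩

lemma IsApproxRel.dist_right_le (h : 𝒳.IsApproxRel 𝒴 r ε R) {x : 𝒳.carrier} {y : 𝒴.carrier}
    (hxy : R x y) : dist y 𝒴.basepoint ≤ dist x 𝒳.basepoint + ε := by
  have := abs_le.1 (h.distortion hxy h.root)
  linarith

lemma IsApproxRel.dist_left_le (h : 𝒳.IsApproxRel 𝒴 r ε R) {x : 𝒳.carrier} {y : 𝒴.carrier}
    (hxy : R x y) : dist x 𝒳.basepoint ≤ dist y 𝒴.basepoint + ε :=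
  h.swap.dist_right_le hxy

lemma ballSub_set_eq (𝒳 : PMM) (hr : 0 ≤ r) :
    (𝒳.ballSub r).set = Metric.closedBall 𝒳.basepoint r :=
  Set.insert_eq_of_mem (Metric.mem_closedBall_self hr)

lemma ballSub_meas_eq (𝒳 : PMM) (hr : 0 ≤ r) :
    (𝒳.ballSub r).meas = 𝒳.meas.restrict (Metric.closedBall 𝒳.basepoint r) :=
  congrArg 𝒳.meas.restrict (ballSub_set_eq 𝒳 hr)

lemma BoundedlyCompact.ballSub (h : 𝒳.BoundedlyCompact) (hr : 0 ≤ r) :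
    (𝒳.ballSub r).IsCompactSub := by
  refine ⟨?_, ?_⟩
  · rw [ballSub_set_eq 𝒳 hr]
    exact h.1 _ _
  · rw [ballSub_meas_eq 𝒳 hr, Measure.restrict_apply_univ]
    exact h.2 _ _

end PMM

lemma SubPMM.map_toPMM_meas_apply {𝒳 : PMM} (S : SubPMM 𝒳) (hS : MeasurableSet S.set) {Z : Type}
    [MetricSpace Z] [MeasurableSpace Z] [BorelSpace Z] {h : S.toPMM.carrier → Z}
    (hh : Continuous h) {A : Set Z} (hA : MeasurableSet A) :
    S.toPMM.meas.map h A = S.meas ((Subtype.val : S.set → 𝒳.carrier) '' (h ⁻¹' A)) := by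
  rw [Measure.map_apply hh.measurable hA]
  have hb : (borel S.set : MeasurableSpace S.set) = Subtype.instMeasurableSpace :=
    (BorelSpace.measurable_eq (α := S.set)).symm
  refine @Measure.comap_apply _ _ (h ⁻¹' A) (borel S.set) _ Subtype.val Subtype.val_injective ?_ _
    (hh.measurable hA)
  intro s hs
  rw [hb] at hs
  exact hS.subtype_image hs

lemma SubPMM.map_toPMM_meas_univ {𝒳 : PMM} (S : SubPMM 𝒳) (hS : MeasurableSet S.set) {Z : Type}
    [MetricSpace Z] [MeasurableSpace Z] [BorelSpace Z] {h : S.toPMM.carrier → Z}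
    (hh : Continuous h) : S.toPMM.meas.map h Set.univ ≤ S.meas Set.univ := by
  rw [S.map_toPMM_meas_apply hS hh MeasurableSet.univ]
  exact measure_mono (Set.subset_univ _)

lemma prokhorovDist_le {Z : Type*} [MetricSpace Z] [MeasurableSpace Z] {μ ν : Measure Z} {ε : ℝ}
    (hε : 0 < ε) (h₁ : ∀ A, IsClosed A → μ A ≤ ν (Metric.cthickening ε A) + ENNReal.ofReal ε)
    (h₂ : ∀ A, IsClosed A → ν A ≤ μ (Metric.cthickening ε A) + ENNReal.ofReal ε) :
    prokhorovDist μ ν ≤ ε :=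
  csInf_le ⟨0, fun _ h => h.1.le⟩ ⟨hε, fun A hA => ⟨h₁ A hA, h₂ A hA⟩⟩

lemma exists_of_prokhorovDist_lt {Z : Type*} [MetricSpace Z] [MeasurableSpace Z] {μ ν : Measure Z}
    (hμ : μ Set.univ ≠ ⊤) (hν : ν Set.univ ≠ ⊤) {ε : ℝ} (h : prokhorovDist μ ν < ε) :
    ∃ δ < ε, 0 < δ ∧ ∀ A : Set Z, IsClosed A →
      μ A ≤ ν (Metric.cthickening δ A) + ENNReal.ofReal δ ∧
      ν A ≤ μ (Metric.cthickening δ A) + ENNReal.ofReal δ := by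
  have key : ∀ (ρ : Measure Z) (_ : ρ Set.univ ≠ ⊤) (A : Set Z) (t : ℝ), 0 ≤ t →
      ρ A ≤ ENNReal.ofReal ((ρ Set.univ).toReal + t + 1) := by
    intro ρ hρ A t ht
    refine (measure_mono (Set.subset_univ A)).trans ?_
    rw [← ENNReal.ofReal_toReal hρ]
    apply ENNReal.ofReal_le_ofReal
    rw [ENNReal.toReal_ofReal ENNReal.toReal_nonneg]
    linarith
  rw [prokhorovDist] at h
  obtain ⟨δ, hδ, hlt⟩ := exists_lt_of_csInf_lt
    (by exact ⟨(μ Set.univ).toReal + (ν Set.univ).toReal + 1, by positivity, fun A _ =>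
      ⟨(key μ hμ A _ ENNReal.toReal_nonneg).trans le_add_self, by
        rw [add_comm (μ Set.univ).toReal]
        exact (key ν hν A _ ENNReal.toReal_nonneg).trans le_add_self⟩⟩) h
  exact ⟨δ, hlt, hδ.1, hδ.2⟩

lemma GHPEmbedding.value_nonneg {𝒳 𝒴 : PMM} (e : GHPEmbedding 𝒳 𝒴) : 0 ≤ e.value :=
  dist_nonneg.trans (le_max_left _ _)

lemma cGHP_nonneg (𝒳 𝒴 : PMM) : 0 ≤ cGHP 𝒳 𝒴 :=
  Real.sInf_nonneg (by rintro _ ⟨e, -, rfl⟩; exact e.value_nonneg)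

lemma cGHP_le {𝒳 𝒴 : PMM} {e : GHPEmbedding 𝒳 𝒴} (he : e.IsIsometric) : cGHP 𝒳 𝒴 ≤ e.value :=
  csInf_le ⟨0, by rintro _ ⟨e, -, rfl⟩; exact e.value_nonneg⟩ ⟨e, he, rfl⟩

lemma exists_embedding_of_cGHP_lt {𝒳 𝒴 : PMM} {ε : ℝ} (h : cGHP 𝒳 𝒴 < ε) :
    ∃ e : GHPEmbedding 𝒳 𝒴, e.IsIsometric ∧ e.value < ε := by
  rw [cGHP] at h
  obtain ⟨_, ⟨e, he, rfl⟩, hlt⟩ := exists_lt_of_csInf_lt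
    (by exact ⟨_, ⟨𝒳.carrier ⊕ 𝒴.carrier, Metric.metricSpaceSum, Sum.inl, Sum.inr⟩,
      ⟨Metric.isometry_inl, Metric.isometry_inr⟩, rfl⟩) h
  exact ⟨e, he, hlt⟩

lemma aFun_le {𝒳 𝒴 : PMM} {ε r : ℝ} {Y' : SubPMM 𝒴} (hY : Y'.IsCompactSub)
    (hle : 𝒴.ballSub (r - ε) ≤ Y') : aFun ε r 𝒳 𝒴 ≤ cGHP ((𝒳.ballSub r).toPMM) Y'.toPMM :=
  csInf_le ⟨0, by rintro _ ⟨_, -, -, rfl⟩; exact cGHP_nonneg _ _⟩ ⟨Y', hY, hle, rfl⟩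

lemma GHP_nonneg (𝒳 𝒴 : PMM) : 0 ≤ GHP 𝒳 𝒴 := by
  refine Real.sInf_nonneg ?_
  rintro _ (rfl | h)
  · exact zero_le_one
  · exact h.1.1.le

lemma GHP_le {𝒳 𝒴 : PMM} {ε : ℝ} (hε : 0 < ε) (h1 : ε ≤ 1) (h₁ : aEps ε 𝒳 𝒴 < ε / 2)
    (h₂ : aEps ε 𝒴 𝒳 < ε / 2) : GHP 𝒳 𝒴 ≤ ε := by
  refine csInf_le ⟨0, ?_⟩ (Or.inr ⟨⟨hε, h1⟩, max_lt h₁ h₂⟩)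
  rintro _ (rfl | h)
  · exact zero_le_one
  · exact h.1.1.le

/-- Closeness of a ball of `𝒳` to a large enough subspace of `𝒴` yields an approximate relation. -/
lemma approx_of_aFun_lt {𝒳 𝒴 : PMM} (h𝒳 : 𝒳.BoundedlyCompact) (h𝒴 : 𝒴.BoundedlyCompact)
    {ε r : ℝ} (hε : 0 < ε) (hr : ε ≤ r) (h : aFun ε r 𝒳 𝒴 < ε / 2) :
    𝒳.Approx 𝒴 (r - ε) ε := by
  have hr0 : 0 ≤ r := hε.le.trans hr
  have hrε : 0 ≤ r - ε := sub_nonneg.2 hr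
  rw [aFun] at h
  obtain ⟨_, ⟨Y', hY', hle, rfl⟩, hlt⟩ := exists_lt_of_csInf_lt
    (by exact ⟨_, 𝒴.ballSub (r - ε), h𝒴.ballSub hrε, ⟨subset_rfl, le_rfl⟩, rfl⟩) h
  obtain ⟨e, ⟨hf, hg⟩, hval⟩ := exists_embedding_of_cGHP_lt hlt
  let _ : MeasurableSpace e.Z := borel e.Z
  have : BorelSpace e.Z := ⟨rfl⟩
  have hroot : dist (e.f (𝒳.ballSub r).toPMM.basepoint) (e.g Y'.toPMM.basepoint) < ε / 2 :=
    (le_max_left _ _).trans_lt hval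
  have hH : Metric.hausdorffDist (Set.range e.f) (Set.range e.g) < ε / 2 :=
    ((le_max_left _ _).trans (le_max_right _ _)).trans_lt hval
  have hP : prokhorovDist ((𝒳.ballSub r).toPMM.meas.map e.f) (Y'.toPMM.meas.map e.g) < ε / 2 :=
    ((le_max_right _ _).trans (le_max_right _ _)).trans_lt hval
  have hXc := h𝒳.ballSub hr0
  have hXm : MeasurableSet (𝒳.ballSub r).set := hXc.1.isClosed.measurableSet
  have hYm : MeasurableSet Y'.set := hY'.1.isClosed.measurableSet
  obtain ⟨δ, hδε, hδ, hPδ⟩ := exists_of_prokhorovDist_lt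
    (((SubPMM.map_toPMM_meas_univ _ hXm hf.continuous).trans_lt hXc.2.lt_top).ne)
    (((SubPMM.map_toPMM_meas_univ _ hYm hg.continuous).trans_lt hY'.2.lt_top).ne) hP
  have : CompactSpace (𝒳.ballSub r).toPMM.carrier := isCompact_iff_compactSpace.1 hXc.1
  have : CompactSpace Y'.toPMM.carrier := isCompact_iff_compactSpace.1 hY'.1
  have hfin : Metric.hausdorffEDist (Set.range e.f) (Set.range e.g) ≠ ⊤ :=
    Metric.hausdorffEDist_ne_top_of_nonempty_of_bounded ⟨_, ⟨(𝒳.ballSub r).toPMM.basepoint, rfl⟩⟩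
      ⟨_, ⟨Y'.toPMM.basepoint, rfl⟩⟩ (isCompact_range hf.continuous).isBounded
      (isCompact_range hg.continuous).isBounded
  have hthick : ∀ {A : Set e.Z} {z : e.Z}, z ∈ Metric.cthickening δ A → ∃ a ∈ A, dist z a < ε / 2 := by
    intro A z hz
    have : z ∈ Metric.thickening (ε / 2) A :=
      Metric.cthickening_subset_thickening' (by linarith) hδε A hz
    exact Metric.mem_thickening_iff.1 this
  have hball : ∀ {x : 𝒳.carrier}, dist x 𝒳.basepoint ≤ r → x ∈ (𝒳.ballSub r).set := fun hx => by
    rw [PMM.ballSub_set_eq _ hr0]; exact hx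
  have hball' : ∀ {y : 𝒴.carrier}, dist y 𝒴.basepoint ≤ r - ε → y ∈ Y'.set := fun hy => by
    apply hle.1
    rw [PMM.ballSub_set_eq _ hrε]; exact hy
  refine ⟨fun x y => ∃ (hx : x ∈ (𝒳.ballSub r).set) (hy : y ∈ Y'.set),
    dist (e.f ⟨x, hx⟩) (e.g ⟨y, hy⟩) < ε / 2, ?_, ?_, ?_, ?_, ?_, ?_⟩
  · exact ⟨(𝒳.ballSub r).root_mem, Y'.root_mem, hroot⟩
  · rintro x x' y y' ⟨hx, hy, h₁⟩ ⟨hx', hy', h₂⟩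
    have e₁ : dist (e.f ⟨x, hx⟩) (e.f ⟨x', hx'⟩) = dist x x' := hf.dist_eq _ _
    have e₂ : dist (e.g ⟨y, hy⟩) (e.g ⟨y', hy'⟩) = dist y y' := hg.dist_eq _ _
    have := dist_dist_dist_le (e.f ⟨x, hx⟩) (e.f ⟨x', hx'⟩) (e.g ⟨y, hy⟩) (e.g ⟨y', hy'⟩)
    rw [e₁, e₂, Real.dist_eq] at this
    linarith
  · intro x hx
    obtain ⟨_, ⟨y, rfl⟩, hy⟩ := Metric.exists_dist_lt_of_hausdorffDist_lt
      (Set.mem_range_self ⟨x, hball (hx.trans (by linarith))⟩) hH hfin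
    exact ⟨y.1, _, y.2, hy⟩
  · intro y hy
    obtain ⟨_, ⟨x, rfl⟩, hx⟩ := Metric.exists_dist_lt_of_hausdorffDist_lt'
      (Set.mem_range_self ⟨y, hball' hy⟩) hH hfin
    exact ⟨x.1, x.2, _, hx⟩
  · intro A hA
    have hAr : A ⊆ (𝒳.ballSub r).set := fun x hx =>
      hball (le_trans (hA hx) (by linarith))
    set A' : Set e.Z := closure (e.f '' (Subtype.val ⁻¹' A))
    have hc := (hPδ A' isClosed_closure).1
    rw [SubPMM.map_toPMM_meas_apply _ hXm hf.continuous isClosed_closure.measurableSet,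
      SubPMM.map_toPMM_meas_apply _ hYm hg.continuous Metric.isClosed_cthickening.measurableSet,
      PMM.ballSub_meas_eq _ hr0] at hc
    have h1 : 𝒳.meas A ≤ (𝒳.meas.restrict (Metric.closedBall 𝒳.basepoint r))
        (Subtype.val '' (e.f ⁻¹' A')) := by
      refine le_trans ?_ (Measure.le_restrict_apply _ _)
      refine measure_mono fun x hx => ⟨⟨⟨x, hAr hx⟩, subset_closure ⟨⟨x, hAr hx⟩, hx, rfl⟩, rfl⟩, ?_⟩
      exact Metric.closedBall_subset_closedBall (by linarith) (hA hx)
    refine h1.trans (hc.trans (add_le_add ?_ (ENNReal.ofReal_le_ofReal (by linarith))))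
    refine (Y'.meas_le _).trans (measure_mono ?_)
    rintro _ ⟨y, hy, rfl⟩
    replace hy := Metric.cthickening_closure.subset hy
    obtain ⟨_, ⟨x, hx, rfl⟩, hd⟩ := hthick hy
    exact ⟨x.1, hx, x.2, y.2, by rw [dist_comm]; exact hd⟩
  · intro B hB
    have hBr : B ⊆ Y'.set := fun y hy => hball' (hB hy)
    set B' : Set e.Z := closure (e.g '' (Subtype.val ⁻¹' B))
    have hc := (hPδ B' isClosed_closure).2
    rw [SubPMM.map_toPMM_meas_apply _ hXm hf.continuous Metric.isClosed_cthickening.measurableSet,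
      SubPMM.map_toPMM_meas_apply _ hYm hg.continuous isClosed_closure.measurableSet] at hc
    have h1 : 𝒴.meas B ≤ Y'.meas (Subtype.val '' (e.g ⁻¹' B')) := by
      refine le_trans ?_ (hle.2 _)
      rw [PMM.ballSub_meas_eq _ hrε]
      refine le_trans ?_ (Measure.le_restrict_apply _ _)
      exact measure_mono fun y hy =>
        ⟨⟨⟨y, hBr hy⟩, subset_closure ⟨⟨y, hBr hy⟩, hy, rfl⟩, rfl⟩, hB hy⟩
    refine h1.trans (hc.trans (add_le_add ?_ (ENNReal.ofReal_le_ofReal (by linarith))))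
    refine ((𝒳.ballSub r).meas_le _).trans (measure_mono ?_)
    rintro _ ⟨x, hx, rfl⟩
    replace hx := Metric.cthickening_closure.subset hx
    obtain ⟨_, ⟨y, hy, rfl⟩, hd⟩ := hthick hx
    exact ⟨y.1, hy, x.2, y.2, hd⟩

lemma approx_of_GHP_lt {𝒳 𝒴 : PMM} (h𝒳 : 𝒳.BoundedlyCompact) (h𝒴 : 𝒴.BoundedlyCompact)
    {δ : ℝ} (hδ : δ ≤ 1) (h : GHP 𝒳 𝒴 < δ) : 𝒳.Approx 𝒴 (1 / δ - 1) δ := by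
  obtain ⟨ε, hε, hlt⟩ := exists_lt_of_csInf_lt (Set.insert_nonempty _ _) h
  obtain rfl | ⟨⟨hε0, hε1⟩, hmax⟩ := hε
  · exact absurd hlt hδ.not_gt
  have hr : 1 ≤ 1 / ε := by rw [le_div_iff₀ hε0]; linarith
  refine (approx_of_aFun_lt h𝒳 h𝒴 hε0 (hε1.trans hr) ((le_max_left _ _).trans_lt hmax)).mono ?_
    hlt.le
  have : 1 / δ ≤ 1 / ε := one_div_le_one_div_of_le hε0 hlt.le
  linarith

/-- A relation of small distortion is realised by isometric embeddings in a common space. -/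
lemma PMM.IsApproxRel.exists_gluing {𝒳 𝒴 : PMM} {r η : ℝ} {R : 𝒳.carrier → 𝒴.carrier → Prop}
    (h : 𝒳.IsApproxRel 𝒴 r η R) (hη : 0 < η) :
    ∃ (Z : Type) (_ : MetricSpace Z) (i : 𝒳.carrier → Z) (j : 𝒴.carrier → Z),
      Isometry i ∧ Isometry j ∧ ∀ x y, R x y → dist (i x) (j y) ≤ η := by
  let P := {p : 𝒳.carrier × 𝒴.carrier // R p.1 p.2}
  have : Nonempty P := ⟨⟨(_, _), h.root⟩⟩
  let Φ : P → 𝒳.carrier := fun p => p.1.1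
  let Ψ : P → 𝒴.carrier := fun p => p.1.2
  let m : MetricSpace (𝒳.carrier ⊕ 𝒴.carrier) := Metric.glueMetricApprox Φ Ψ η hη
    fun p q => (h.distortion p.2 q.2).trans (by linarith)
  exact ⟨𝒳.carrier ⊕ 𝒴.carrier, m, Sum.inl, Sum.inr, Isometry.of_dist_eq fun _ _ => rfl,
    Isometry.of_dist_eq fun _ _ => rfl,
    fun x y hxy => (Metric.glueDist_glued_points Φ Ψ η ⟨(x, y), hxy⟩).le⟩

lemma aFun_lt_of_isApproxRel {𝒳 𝒴 : PMM} (h𝒳 : 𝒳.BoundedlyCompact) (h𝒴 : 𝒴.BoundedlyCompact)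
    {r ε η : ℝ} {R : 𝒳.carrier → 𝒴.carrier → Prop} (h : 𝒳.IsApproxRel 𝒴 (r + 1) η R)
    (hη : 0 < η) (hηε : 8 * η ≤ ε) (hε1 : ε ≤ 1) (hr : ε ≤ r)
    (hshell : 𝒳.meas {x | r < dist x 𝒳.basepoint ∧ dist x 𝒳.basepoint ≤ r + 2 * η} ≤
      ENNReal.ofReal (ε / 4)) :
    aFun ε r 𝒳 𝒴 < ε / 2 := by
  have hε : 0 < ε := by linarith
  have hr0 : 0 ≤ r := hε.le.trans hr
  obtain ⟨Z, mZ, i, j, hi, hj, hij⟩ := h.exists_gluing hη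
  set V : Set 𝒴.carrier := {y | ∃ x, dist x 𝒳.basepoint ≤ r ∧ R x y} with hV
  have hVr : closure V ⊆ Metric.closedBall 𝒴.basepoint (r + η) := by
    refine closure_minimal ?_ Metric.isClosed_closedBall
    rintro y ⟨x, hx, hxy⟩
    exact (h.dist_right_le hxy).trans (by linarith)
  have hVc : IsCompact (closure V) := (h𝒴.1 _ _).of_isClosed_subset isClosed_closure hVr
  have hrootV : 𝒴.basepoint ∈ closure V := subset_closure ⟨_, by simpa using hr0, h.root⟩
  have hballV : Metric.closedBall 𝒴.basepoint (r - ε) ⊆ closure V := by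
    intro y hy
    obtain ⟨x, hxy⟩ := h.exists_left y (le_trans hy (by linarith))
    refine subset_closure ⟨x, (h.dist_left_le hxy).trans ?_, hxy⟩
    have : dist y 𝒴.basepoint ≤ r - ε := hy
    linarith
  let Y' : SubPMM 𝒴 :=
    { set := closure V
      root_mem := hrootV
      meas := 𝒴.meas.restrict (closure V)
      meas_le := Measure.restrict_le_self
      supported := by
        rw [Measure.restrict_apply isClosed_closure.measurableSet.compl, Set.compl_inter_self]
        simp }
  have hY' : Y'.IsCompactSub := by
    refine ⟨hVc, ?_⟩
    change 𝒴.meas.restrict (closure V) Set.univ ≠ ⊤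
    rw [Measure.restrict_apply_univ]
    exact ((measure_mono hVr).trans_lt (h𝒴.2 _ _).lt_top).ne
  have hle : 𝒴.ballSub (r - ε) ≤ Y' := by
    refine ⟨?_, ?_⟩
    · rw [PMM.ballSub_set_eq _ (sub_nonneg.2 hr)]
      exact hballV
    · rw [PMM.ballSub_meas_eq _ (sub_nonneg.2 hr)]
      exact Measure.restrict_mono hballV le_rfl
  let e : GHPEmbedding (𝒳.ballSub r).toPMM Y'.toPMM :=
    ⟨Z, mZ, fun x => i x.1, fun y => j y.1⟩
  have hf : Isometry e.f := hi.comp isometry_subtype_coe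
  have hg : Isometry e.g := hj.comp isometry_subtype_coe
  refine (aFun_le hY' hle).trans_lt ((cGHP_le (e := e) ⟨hf, hg⟩).trans_lt ?_)
  suffices hval : e.value ≤ 3 * ε / 8 by linarith
  let _ : MeasurableSpace Z := borel Z
  have : BorelSpace Z := ⟨rfl⟩
  have hXset : (𝒳.ballSub r).set = Metric.closedBall 𝒳.basepoint r := PMM.ballSub_set_eq _ hr0
  have hXm : MeasurableSet (𝒳.ballSub r).set := (h𝒳.ballSub hr0).1.isClosed.measurableSet
  have hYm : MeasurableSet Y'.set := isClosed_closure.measurableSet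
  have hXball : ∀ x, x ∈ (𝒳.ballSub r).set ↔ dist x 𝒳.basepoint ≤ r := fun x => by
    rw [hXset]; rfl
  refine max_le ?_ (max_le ?_ ?_)
  · exact (hij _ _ h.root).trans (by linarith)
  · refine Metric.hausdorffDist_le_of_mem_dist (by positivity) ?_ ?_
    · rintro _ ⟨⟨x, hx⟩, rfl⟩
      rw [hXball] at hx
      obtain ⟨y, hxy⟩ := h.exists_right x (hx.trans (by linarith))
      exact ⟨_, ⟨⟨y, subset_closure ⟨x, hx, hxy⟩⟩, rfl⟩, (hij _ _ hxy).trans (by linarith)⟩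
    · rintro _ ⟨⟨y, hy⟩, rfl⟩
      obtain ⟨y', ⟨x, hx, hxy⟩, hd⟩ := Metric.mem_closure_iff.1 hy η hη
      refine ⟨_, ⟨⟨x, (hXball x).2 hx⟩, rfl⟩, ?_⟩
      have h1 : dist (j y) (j y') < η := by rwa [hj.dist_eq]
      have h2 : dist (j y') (i x) ≤ η := by rw [dist_comm]; exact hij _ _ hxy
      have h3 : dist (j y) (i x) ≤ 3 * ε / 8 := by
        linarith [dist_triangle (j y) (j y') (i x)]
      exact h3
  · refine prokhorovDist_le (by positivity) ?_ ?_
    · intro A hA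
      rw [SubPMM.map_toPMM_meas_apply _ hXm hf.continuous hA.measurableSet,
        SubPMM.map_toPMM_meas_apply _ hYm hg.continuous Metric.isClosed_cthickening.measurableSet]
      refine ((𝒳.ballSub r).meas_le _).trans ((h.meas_le_right _ ?_).trans
        (add_le_add ?_ (ENNReal.ofReal_le_ofReal (by linarith))))
      · rintro _ ⟨⟨x, hx⟩, -, rfl⟩
        exact ((hXball x).1 hx).trans (by linarith)
      · refine le_trans (measure_mono ?_) (Measure.le_restrict_apply _ _)
        rintro y ⟨_, ⟨⟨x, hx⟩, hxA, rfl⟩, hxy⟩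
        have hyV : y ∈ closure V := subset_closure ⟨x, (hXball x).1 hx, hxy⟩
        refine ⟨⟨⟨y, hyV⟩, ?_, rfl⟩, hyV⟩
        refine Metric.mem_cthickening_of_dist_le _ (i x) _ _ hxA ?_
        rw [dist_comm]
        exact (hij _ _ hxy).trans (by linarith)
    · intro A hA
      rw [SubPMM.map_toPMM_meas_apply _ hYm hg.continuous hA.measurableSet,
        SubPMM.map_toPMM_meas_apply _ hXm hf.continuous Metric.isClosed_cthickening.measurableSet,
        PMM.ballSub_meas_eq _ hr0]
      refine (Y'.meas_le _).trans ((h.meas_le_left _ ?_).trans ?_)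
      · rintro _ ⟨⟨y, hy⟩, -, rfl⟩
        exact Metric.closedBall_subset_closedBall (by linarith) (hVr hy)
      set C : Set 𝒳.carrier := Subtype.val '' (e.f ⁻¹' Metric.cthickening (3 * ε / 8) A)
      have hsub : {x | ∃ y ∈ (Subtype.val '' (e.g ⁻¹' A) : Set 𝒴.carrier), R x y} ⊆
          (C ∩ Metric.closedBall 𝒳.basepoint r) ∪
            {x | r < dist x 𝒳.basepoint ∧ dist x 𝒳.basepoint ≤ r + 2 * η} := by
        rintro x ⟨_, ⟨⟨y, hy⟩, hyA, rfl⟩, hxy⟩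
        by_cases hxr : dist x 𝒳.basepoint ≤ r
        · refine Or.inl ⟨⟨⟨x, (hXball x).2 hxr⟩, ?_, rfl⟩, hxr⟩
          exact Metric.mem_cthickening_of_dist_le _ (j y) _ _ hyA
            ((hij _ _ hxy).trans (by linarith))
        · refine Or.inr ⟨not_le.1 hxr, (h.dist_left_le hxy).trans ?_⟩
          have : dist y 𝒴.basepoint ≤ r + η := hVr hy
          linarith
      calc _ ≤ (𝒳.meas (C ∩ Metric.closedBall 𝒳.basepoint r) + ENNReal.ofReal (ε / 4))
            + ENNReal.ofReal η :=
            add_le_add_left ((measure_mono hsub).trans ((measure_union_le _ _).trans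
              (add_le_add_right hshell _))) _
        _ ≤ _ := by
            rw [add_assoc, ← ENNReal.ofReal_add (by positivity) hη.le]
            exact add_le_add (Measure.le_restrict_apply _ _)
              (ENNReal.ofReal_le_ofReal (by linarith))

/-- Around a fixed limit space, sufficiently good approximate relations force a small distance. -/
lemma exists_GHP_lt_of_approx {𝒴 : PMM} (h𝒴 : 𝒴.BoundedlyCompact) {δ : ℝ} (hδ : 0 < δ) :
    ∃ r η : ℝ, 0 < r ∧ 0 < η ∧
      ∀ 𝒳 : PMM, 𝒳.BoundedlyCompact → 𝒳.Approx 𝒴 r η → GHP 𝒳 𝒴 < δ := by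
  set s : ℝ := max 1 (1 / δ) with hs
  let μ : Measure 𝒴.carrier := 𝒴.meas.restrict (Metric.closedBall 𝒴.basepoint (s + 2))
  have : IsFiniteMeasure μ := ⟨by
    rw [Measure.restrict_apply_univ]; exact (h𝒴.2 _ _).lt_top⟩
  have hmeas : Measurable fun y : 𝒴.carrier => dist y 𝒴.basepoint := by fun_prop
  have hcount := Measure.countable_meas_level_set_pos (μ := μ) hmeas
  obtain ⟨r, ⟨hsr, hrs⟩, hr⟩ : (Set.Ioo s (s + 1) \
      {t | 0 < μ {y | dist y 𝒴.basepoint = t}}).Nonempty := by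
    obtain ⟨t, ht, hst⟩ := (hcount.dense_compl ℝ).exists_between (lt_add_one s)
    exact ⟨t, hst, ht⟩
  have hr1 : 1 < r := (le_max_left _ _).trans_lt hsr
  have hr0 : 0 < r := by linarith
  have hrδ : 1 / r < δ := by
    rw [div_lt_comm₀ hr0 hδ]
    exact (le_max_right _ _).trans_lt hsr
  set ε : ℝ := 1 / r with hεdef
  have hε : 0 < ε := by positivity
  have hε1 : ε ≤ 1 := by rw [hεdef, div_le_one hr0]; exact hr1.le
  have hnull : μ {y | dist y 𝒴.basepoint = r} = 0 := by
    simpa using hr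
  let T : ℝ → Set 𝒴.carrier := fun η => {y | dist (dist y 𝒴.basepoint) r ≤ η}
  have hlim : Tendsto (fun η => μ (T η)) (𝓝[>] 0) (𝓝 0) := by
    have hinter : ⋂ η > (0 : ℝ), T η = {y | dist y 𝒴.basepoint = r} := by
      ext y
      simp only [Set.mem_iInter, T, Set.mem_ofPred_eq]
      constructor
      · intro hy
        exact dist_le_zero.1 (le_of_forall_gt_imp_ge_of_dense hy)
      · intro hy η hη
        rw [hy, dist_self]
        exact le_of_lt hη
    rw [← hnull, ← hinter]
    refine tendsto_measure_biInter_gt (fun η _ => ?_) (fun i j _ hij y hy => le_trans hy hij)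
      ⟨1, one_pos, measure_ne_top _ _⟩
    exact (isClosed_le (by fun_prop) continuous_const).measurableSet.nullMeasurableSet
  have hev : ∀ᶠ η in 𝓝[>] (0 : ℝ), μ (T (4 * η)) < ENNReal.ofReal (ε / 8) := by
    have h4 : Tendsto (fun η : ℝ => 4 * η) (𝓝[>] 0) (𝓝[>] 0) := by
      refine tendsto_nhdsWithin_of_tendsto_nhds_of_eventually_within _ ?_ ?_
      · exact ((continuous_const_mul (4 : ℝ)).tendsto' 0 0 (by simp)).mono_left
          nhdsWithin_le_nhds
      · filter_upwards [self_mem_nhdsWithin] with η hη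
        exact mul_pos four_pos (Set.mem_Ioi.1 hη)
    exact (hlim.comp h4).eventually (gt_mem_nhds (ENNReal.ofReal_pos.2 (by positivity)))
  obtain ⟨η, hηT, hη0, hη8⟩ := (hev.and
    (Ioc_mem_nhdsGT (show (0 : ℝ) < ε / 8 by positivity))).exists
  have hTμ : ∀ A ⊆ T (4 * η), 𝒴.meas A ≤ ENNReal.ofReal (ε / 8) := by
    intro A hA
    refine le_trans ?_ hηT.le
    refine le_trans (measure_mono (t := T (4 * η) ∩ Metric.closedBall 𝒴.basepoint (s + 2))
      fun y hy => ⟨hA hy, ?_⟩) (Measure.le_restrict_apply _ _)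
    have := hA hy
    simp only [T, Set.mem_ofPred_eq, Real.dist_eq, abs_le] at this
    change dist y 𝒴.basepoint ≤ s + 2
    linarith
  refine ⟨r + 1, η, by linarith, hη0, fun 𝒳 h𝒳 ⟨R, hR⟩ => ?_⟩
  have hεr : 1 / ε = r := by simp [hεdef]
  have hmemT : ∀ {y : 𝒴.carrier}, r - 4 * η ≤ dist y 𝒴.basepoint →
      dist y 𝒴.basepoint ≤ r + 4 * η → y ∈ T (4 * η) := by
    intro y h₁ h₂
    simp only [T, Set.mem_ofPred_eq, Real.dist_eq, abs_le]
    constructor <;> linarith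
  refine (GHP_le hε hε1 ?_ ?_).trans_lt hrδ
  · rw [aEps, hεr]
    refine aFun_lt_of_isApproxRel h𝒳 h𝒴 hR hη0 (by linarith) hε1 (by linarith) ?_
    refine (hR.meas_le_right _ ?_).trans ?_
    · rintro x ⟨-, hx⟩
      exact hx.trans (by linarith)
    · refine (add_le_add (hTμ _ ?_) (ENNReal.ofReal_le_ofReal hη8)).trans ?_
      · rintro y ⟨x, ⟨hx₁, hx₂⟩, hxy⟩
        have h₁ := hR.dist_left_le hxy
        have h₂ := hR.dist_right_le hxy
        exact hmemT (by linarith) (by linarith)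
      · rw [← ENNReal.ofReal_add (by positivity) (by positivity)]
        exact ENNReal.ofReal_le_ofReal (by linarith)
  · rw [aEps, hεr]
    refine aFun_lt_of_isApproxRel h𝒴 h𝒳 hR.swap hη0 (by linarith) hε1 (by linarith) ?_
    refine (hTμ _ ?_).trans (ENNReal.ofReal_le_ofReal (by linarith))
    rintro y ⟨hy₁, hy₂⟩
    exact hmemT (by linarith) (by linarith)

/-- A sequence with values eventually in a compact set converges along the hyperfilter. -/
lemma IsCompact.exists_tendsto_hyperfilter {α : Type*} [TopologicalSpace α] {K : Set α}
    (hK : IsCompact K) {u : ℕ → α} (hu : ∀ᶠ m in (hyperfilter ℕ : Filter ℕ), u m ∈ K) :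
    ∃ a ∈ K, Tendsto u (hyperfilter ℕ) (𝓝 a) :=
  hK.ultrafilter_le_nhds ((hyperfilter ℕ).map u) (le_principal_iff.2 hu)

/-- The sequences of points at bounded distance from the basepoints. -/
def BddSeq (X : ℕ → PMM) : Type :=
  {z : ∀ m, (X m).carrier // ∃ C : ℝ, ∀ m, dist (z m) (X m).basepoint ≤ C}

namespace BddSeq

variable {X : ℕ → PMM}

lemma exists_tendsto_dist (z z' : BddSeq X) :
    ∃ d : ℝ, Tendsto (fun m => dist (z.1 m) (z'.1 m)) (hyperfilter ℕ) (𝓝 d) := by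
  obtain ⟨C, hC⟩ := z.2
  obtain ⟨C', hC'⟩ := z'.2
  obtain ⟨d, -, hd⟩ := (isCompact_Icc (a := (0 : ℝ)) (b := C + C')).exists_tendsto_hyperfilter
    (u := fun m => dist (z.1 m) (z'.1 m)) (Eventually.of_forall fun m => ⟨dist_nonneg,
      (dist_triangle_right _ _ (X m).basepoint).trans (add_le_add (hC m) (hC' m))⟩)
  exact ⟨d, hd⟩

instance : PseudoMetricSpace (BddSeq X) where
  dist z z' := limUnder (hyperfilter ℕ : Filter ℕ) fun m => dist (z.1 m) (z'.1 m)
  dist_self z := by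
    simp only [dist_self]
    exact tendsto_const_nhds.limUnder_eq
  dist_comm z z' := by simp only [dist_comm]
  dist_triangle x y z :=
    le_of_tendsto_of_tendsto (tendsto_nhds_limUnder (exists_tendsto_dist x z))
      ((tendsto_nhds_limUnder (exists_tendsto_dist x y)).add
        (tendsto_nhds_limUnder (exists_tendsto_dist y z)))
      (Eventually.of_forall fun _ => dist_triangle _ _ _)

lemma tendsto_dist (z z' : BddSeq X) :
    Tendsto (fun m => dist (z.1 m) (z'.1 m)) (hyperfilter ℕ) (𝓝 (dist z z')) :=
  tendsto_nhds_limUnder (exists_tendsto_dist z z')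

instance : CompleteSpace (BddSeq X) := by
  refine Metric.complete_of_convergent_controlled_sequences (fun N => (1 / 2 : ℝ) ^ N)
    (fun N => by positivity) fun u hu => ?_
  let P : ℕ → ℕ → Prop := fun m j => ∀ i ≤ j, dist ((u i).1 m) ((u j).1 m) < (1 / 2 : ℝ) ^ i
  classical
  let J : ℕ → ℕ := fun m => Nat.findGreatest (P m) m
  have hP : ∀ m, P m (J m) := by
    intro m
    refine Nat.findGreatest_spec (m := 0) (Nat.zero_le m) ?_
    intro i hi
    obtain rfl : i = 0 := by omega
    simp
  obtain ⟨C, hC⟩ := (u 0).2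
  let z : BddSeq X := ⟨fun m => (u (J m)).1 m, C + 1, fun m => by
    have h := hP m 0 (Nat.zero_le _)
    rw [pow_zero] at h
    have := dist_triangle_left ((u (J m)).1 m) (X m).basepoint ((u 0).1 m)
    linarith [hC m]⟩
  have hz : ∀ j, dist (u j) z ≤ (1 / 2 : ℝ) ^ j := by
    intro j
    have hPj : ∀ᶠ m in (hyperfilter ℕ : Filter ℕ), P m j := by
      refine (eventually_all_finite (Set.finite_Iic j)).2 fun i hi => ?_
      exact (tendsto_dist (u i) (u j)).eventually (gt_mem_nhds (hu i i j le_rfl hi))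
    refine le_of_tendsto (tendsto_dist (u j) z) ?_
    filter_upwards [hPj, Nat.hyperfilter_le_atTop (eventually_ge_atTop j)] with m hm hjm
    exact (hP m j (Nat.le_findGreatest hjm hm)).le
  refine ⟨z, tendsto_iff_dist_tendsto_zero.2 (squeeze_zero (fun _ => dist_nonneg) hz ?_)⟩
  exact tendsto_pow_atTop_nhds_zero_of_lt_one (by norm_num) (by norm_num)

end BddSeq

/-- The ultralimit of a sequence of pointed metric spaces. -/
abbrev UltraLim (X : ℕ → PMM) : Type := SeparationQuotient (BddSeq X)

namespace UltraLim

variable {X : ℕ → PMM}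

/-- The basepoint of the ultralimit. -/
def root (X : ℕ → PMM) : UltraLim X :=
  SeparationQuotient.mk ⟨fun m => (X m).basepoint, 0, fun _ => (dist_self _).le⟩

lemma tendsto_dist (z z' : BddSeq X) :
    Tendsto (fun m => dist (z.1 m) (z'.1 m)) (hyperfilter ℕ)
      (𝓝 (dist (SeparationQuotient.mk z : UltraLim X) (SeparationQuotient.mk z'))) := by
  rw [SeparationQuotient.dist_mk]
  exact BddSeq.tendsto_dist z z'

lemma tendsto_dist_root (z : BddSeq X) :
    Tendsto (fun m => dist (z.1 m) (X m).basepoint) (hyperfilter ℕ)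
      (𝓝 (dist (SeparationQuotient.mk z : UltraLim X) (root X))) :=
  tendsto_dist z _

/-- Any eventually bounded sequence of points agrees eventually with a bounded sequence. -/
lemma exists_bddSeq {p : ∀ m, (X m).carrier → Prop} {C : ℝ}
    (h : ∀ᶠ m in (hyperfilter ℕ : Filter ℕ), ∃ y, p m y ∧ dist y (X m).basepoint ≤ C) :
    ∃ z : BddSeq X, ∀ᶠ m in (hyperfilter ℕ : Filter ℕ),
      p m (z.1 m) ∧ dist (z.1 m) (X m).basepoint ≤ C := by
  classical
  let z : ∀ m, (X m).carrier := fun m =>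
    if h : ∃ y, p m y ∧ dist y (X m).basepoint ≤ C then h.choose else (X m).basepoint
  have hz : ∀ m, (∃ y, p m y ∧ dist y (X m).basepoint ≤ C) →
      p m (z m) ∧ dist (z m) (X m).basepoint ≤ C := by
    intro m hm
    simp only [z, dif_pos hm]
    exact hm.choose_spec
  refine ⟨⟨z, max C 0, fun m => ?_⟩, h.mono hz⟩
  by_cases hm : ∃ y, p m y ∧ dist y (X m).basepoint ≤ C
  · exact (hz m hm).2.trans (le_max_left _ _)
  · simp only [z, dif_neg hm, dist_self]
    exact le_max_right _ _

/-- The limit of a sequence of relations between a fixed space and the terms of a sequence. -/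
def limRel {𝒜 : PMM} (R : ∀ m, 𝒜.carrier → (X m).carrier → Prop)
    (x : 𝒜.carrier) (y : UltraLim X) : Prop :=
  ∃ z : BddSeq X, SeparationQuotient.mk z = y ∧ ∃ u : ℕ → 𝒜.carrier,
    Tendsto u (hyperfilter ℕ) (𝓝 x) ∧ ∀ᶠ m in (hyperfilter ℕ : Filter ℕ), R m (u m) (z.1 m)

section limRel

variable {𝒜 : PMM} {R : ∀ m, 𝒜.carrier → (X m).carrier → Prop} {r ε : ℝ}

lemma limRel_root (hR : ∀ᶠ m in (hyperfilter ℕ : Filter ℕ), 𝒜.IsApproxRel (X m) r ε (R m)) :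
    limRel R 𝒜.basepoint (root X) :=
  ⟨_, rfl, fun _ => 𝒜.basepoint, tendsto_const_nhds, hR.mono fun _ h => h.root⟩

lemma limRel_distortion
    (hR : ∀ᶠ m in (hyperfilter ℕ : Filter ℕ), 𝒜.IsApproxRel (X m) r ε (R m))
    {x x' : 𝒜.carrier} {y y' : UltraLim X} (h : limRel R x y) (h' : limRel R x' y') :
    |dist x x' - dist y y'| ≤ ε := by
  obtain ⟨z, rfl, u, hu, hz⟩ := h
  obtain ⟨z', rfl, u', hu', hz'⟩ := h'
  refine le_of_tendsto ((hu.dist hu').sub (tendsto_dist z z')).abs ?_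
  filter_upwards [hR, hz, hz'] with m hm h₁ h₂
  exact hm.distortion h₁ h₂

lemma exists_limRel_right
    (hR : ∀ᶠ m in (hyperfilter ℕ : Filter ℕ), 𝒜.IsApproxRel (X m) r ε (R m))
    {x : 𝒜.carrier} (hx : dist x 𝒜.basepoint ≤ r) : ∃ y : UltraLim X, limRel R x y := by
  obtain ⟨z, hz⟩ := exists_bddSeq (X := X) (p := fun m y => R m x y) (C := r + ε) <| by
    filter_upwards [hR] with m hm
    obtain ⟨y, hy⟩ := hm.exists_right x hx
    exact ⟨y, hy, (hm.dist_right_le hy).trans (by linarith)⟩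
  exact ⟨_, z, rfl, fun _ => x, tendsto_const_nhds, hz.mono fun _ h => h.1⟩

/-- Bounded sequences of related points have related limits. -/
lemma exists_limRel_of_eventually (h𝒜 : 𝒜.BoundedlyCompact)
    (hR : ∀ᶠ m in (hyperfilter ℕ : Filter ℕ), 𝒜.IsApproxRel (X m) r ε (R m))
    (z : BddSeq X) {u : ℕ → 𝒜.carrier}
    (h : ∀ᶠ m in (hyperfilter ℕ : Filter ℕ), R m (u m) (z.1 m)) :
    ∃ x, Tendsto u (hyperfilter ℕ) (𝓝 x) ∧ limRel R x (SeparationQuotient.mk z) := by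
  obtain ⟨C, hC⟩ := z.2
  obtain ⟨x, -, hx⟩ := (h𝒜.1 𝒜.basepoint (C + ε)).exists_tendsto_hyperfilter (u := u) <| by
    filter_upwards [hR, h] with m hm h₁
    exact (hm.dist_left_le h₁).trans (by linarith [hC m])
  exact ⟨x, hx, z, rfl, u, hx, h⟩

lemma exists_limRel_left (h𝒜 : 𝒜.BoundedlyCompact)
    (hR : ∀ᶠ m in (hyperfilter ℕ : Filter ℕ), 𝒜.IsApproxRel (X m) r ε (R m))
    {y : UltraLim X} (hy : dist y (root X) < r) : ∃ x, limRel R x y := by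
  obtain ⟨z, rfl⟩ := SeparationQuotient.surjective_mk y
  have h : ∀ᶠ m in (hyperfilter ℕ : Filter ℕ), ∃ x, R m x (z.1 m) := by
    filter_upwards [hR, (tendsto_dist_root z).eventually (gt_mem_nhds hy)] with m hm h₁
    exact hm.exists_left _ h₁.le
  obtain ⟨u, hu⟩ := h.choice
  obtain ⟨x, -, hx⟩ := exists_limRel_of_eventually h𝒜 hR z hu
  exact ⟨x, hx⟩

end limRel

/-- A sequence of spaces is asymptotically Cauchy if its terms are eventually related by
approximate relations of arbitrarily large radius and arbitrarily small distortion. -/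
def IsCauchy (X : ℕ → PMM) : Prop :=
  (∀ n, (X n).BoundedlyCompact) ∧
    ∀ r ε : ℝ, 0 < ε → ∃ N, ∀ m ≥ N, ∀ n ≥ N, (X m).Approx (X n) r ε

lemma IsCauchy.exists_rel (hX : IsCauchy X) (r : ℝ) {ε : ℝ} (hε : 0 < ε) :
    ∃ N, ∀ n ≥ N, ∃ R : ∀ m, (X n).carrier → (X m).carrier → Prop,
      ∀ᶠ m in (hyperfilter ℕ : Filter ℕ), (X n).IsApproxRel (X m) r ε (R m) := by
  obtain ⟨N, hN⟩ := hX.2 r ε hε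
  refine ⟨N, fun n hn => ?_⟩
  have h : ∀ᶠ m in (hyperfilter ℕ : Filter ℕ), (X n).Approx (X m) r ε :=
    Nat.hyperfilter_le_atTop <| (eventually_ge_atTop N).mono fun m hm => hN n hn m hm
  classical
  refine ⟨fun m => if h : (X n).Approx (X m) r ε then h.choose else fun _ _ => False, ?_⟩
  filter_upwards [h] with m hm
  simp only [dif_pos hm]
  exact hm.choose_spec

lemma IsCauchy.totallyBounded_closedBall (hX : IsCauchy X) (r : ℝ) :
    TotallyBounded (Metric.closedBall (root X) r) := by
  refine Metric.totallyBounded_of_finite_discretization fun ε hε => ?_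
  obtain ⟨N, hN⟩ := hX.exists_rel (r + 1) (ε := ε / 4) (by positivity)
  obtain ⟨R, hR⟩ := hN N le_rfl
  obtain ⟨t, -, htf, ht⟩ := (hX.1 N).1 (X N).basepoint (r + ε) |>.finite_cover_balls
    (e := ε / 4) (by positivity)
  have hF : ∀ y : Metric.closedBall (root X) r, ∃ f : t, ∃ x, limRel R x y.1 ∧
      dist x f.1 < ε / 4 := by
    rintro ⟨y, hy⟩
    rw [Metric.mem_closedBall] at hy
    obtain ⟨x, hx⟩ := exists_limRel_left (hX.1 N) hR (hy.trans_lt (lt_add_one r))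
    have hd := abs_le.1 (limRel_distortion hR hx (limRel_root hR))
    have hxt := ht (show x ∈ Metric.closedBall (X N).basepoint (r + ε) by
      rw [Metric.mem_closedBall]; linarith)
    simp only [Set.mem_iUnion, exists_prop] at hxt
    obtain ⟨f, hf, hxf⟩ := hxt
    exact ⟨⟨f, hf⟩, x, hx, hxf⟩
  choose F G hG hFG using hF
  refine ⟨t, htf.fintype, F, fun y y' h => ?_⟩
  have hd := abs_le.1 (limRel_distortion hR (hG y) (hG y'))
  have h₁ := dist_triangle_right (G y) (G y') (F y).1
  have h₂ := hFG y
  have h₃ := hFG y'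
  rw [← h] at h₃
  linarith

lemma IsCauchy.isCompact_closedBall (hX : IsCauchy X) (y : UltraLim X) (r : ℝ) :
    IsCompact (Metric.closedBall y r) := by
  refine IsCompact.of_isClosed_subset ?_ Metric.isClosed_closedBall
    (Metric.closedBall_subset_closedBall' (ε₂ := r + dist y (root X)) le_rfl)
  exact isCompact_iff_totallyBounded_isComplete.2
    ⟨hX.totallyBounded_closedBall _, Metric.isClosed_closedBall.isComplete⟩

lemma IsCauchy.exists_meas_closedBall_le (hX : IsCauchy X) (r : ℝ) :
    ∃ c : ENNReal, c ≠ ⊤ ∧ ∀ᶠ m in (hyperfilter ℕ : Filter ℕ),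
      (X m).meas (Metric.closedBall (X m).basepoint r) ≤ c := by
  obtain ⟨N, hN⟩ := hX.exists_rel r one_pos
  obtain ⟨R, hR⟩ := hN N le_rfl
  refine ⟨(X N).meas (Metric.closedBall (X N).basepoint (r + 1)) + ENNReal.ofReal 1,
    ENNReal.add_ne_top.2 ⟨(hX.1 N).2 _ _, ENNReal.ofReal_ne_top⟩, ?_⟩
  filter_upwards [hR] with m hm
  refine (hm.meas_le_left _ subset_rfl).trans (add_le_add_left (measure_mono ?_) _)
  rintro x ⟨y, hy, hxy⟩
  exact (hm.dist_left_le hxy).trans (by simpa using hy)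

end UltraLim

namespace UltraLim

variable {X : ℕ → PMM}

instance instMeasurableSpace : MeasurableSpace (UltraLim X) := borel _

instance instBorelSpace : BorelSpace (UltraLim X) := ⟨rfl⟩

/-- A sequence of sets covers `K` if it eventually contains every bounded sequence of points
whose class lies in `K`. -/
def Covers (A : ∀ m, Set (X m).carrier) (K : Set (UltraLim X)) : Prop :=
  ∀ z : BddSeq X, SeparationQuotient.mk z ∈ K →
    ∀ᶠ m in (hyperfilter ℕ : Filter ℕ), z.1 m ∈ A m

/-- The least asymptotic mass of a sequence of sets covering `K`. -/
def mass (K : Set (UltraLim X)) : ENNReal :=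
  sInf {c | ∃ A : ∀ m, Set (X m).carrier, Covers A K ∧
    ∀ᶠ m in (hyperfilter ℕ : Filter ℕ), (X m).meas (A m) ≤ c}

lemma mass_le {K : Set (UltraLim X)} {A : ∀ m, Set (X m).carrier} (hA : Covers A K)
    {c : ENNReal} (hc : ∀ᶠ m in (hyperfilter ℕ : Filter ℕ), (X m).meas (A m) ≤ c) :
    mass K ≤ c :=
  sInf_le ⟨A, hA, hc⟩

lemma mass_mono {K L : Set (UltraLim X)} (h : K ⊆ L) : mass K ≤ mass L :=
  sInf_le_sInf fun _ ⟨A, hA, hc⟩ => ⟨A, fun z hz => hA z (h hz), hc⟩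

lemma mass_union_le (K L : Set (UltraLim X)) : mass (K ∪ L) ≤ mass K + mass L := by
  refine ENNReal.le_of_forall_pos_le_add fun ε hε hlt => ?_
  obtain ⟨hK, hL⟩ := ENNReal.add_lt_top.1 hlt
  have hε2 : (ε / 2 : ENNReal) ≠ 0 := by simpa using hε.ne'
  obtain ⟨a, ⟨A, hA, hAa⟩, ha⟩ := sInf_lt_iff.1 (ENNReal.lt_add_right hK.ne hε2)
  obtain ⟨b, ⟨B, hB, hBb⟩, hb⟩ := sInf_lt_iff.1 (ENNReal.lt_add_right hL.ne hε2)
  refine mass_le (A := fun m => A m ∪ B m) ?_ ?_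
  · rintro z (hz | hz)
    · exact (hA z hz).mono fun m => Or.inl
    · exact (hB z hz).mono fun m => Or.inr
  · filter_upwards [hAa, hBb] with m h₁ h₂
    refine (measure_union_le _ _).trans
      ((add_le_add (h₁.trans ha.le) (h₂.trans hb.le)).trans (le_of_eq ?_))
    change mass K + (ε / 2 : ENNReal) + (mass L + ε / 2) = _
    rw [add_add_add_comm, ENNReal.add_halves]

lemma mass_add_le_of_disjoint {K L : Set (UltraLim X)} (hK : IsCompact K) (hL : IsClosed L)
    (hKL : Disjoint K L) : mass K + mass L ≤ mass (K ∪ L) := by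
  refine le_sInf ?_
  rintro c ⟨A, hA, hc⟩
  obtain ⟨δ, hδ, hdisj⟩ := hKL.exists_thickenings hK hL
  obtain ⟨t, htK, htf, ht⟩ := hK.finite_cover_balls (e := δ / 2) (by positivity)
  obtain ⟨g, hg⟩ := (SeparationQuotient.surjective_mk (X := BddSeq X)).hasRightInverse
  let M : ∀ m, Set (X m).carrier := fun m => ⋃ f ∈ t, Metric.ball ((g f).1 m) (δ / 2)
  have hMK : Covers (fun m => A m ∩ M m) K := by
    intro z hz
    have hzt := ht hz
    simp only [Set.mem_iUnion, exists_prop] at hzt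
    obtain ⟨f, hf, hzf⟩ := hzt
    rw [Metric.mem_ball, ← hg f] at hzf
    filter_upwards [hA z (Or.inl hz), (tendsto_dist z (g f)).eventually (gt_mem_nhds hzf)]
      with m h₁ h₂
    exact ⟨h₁, Set.mem_biUnion hf h₂⟩
  have hML : Covers (fun m => A m \ M m) L := by
    intro z hz
    have hfar : ∀ᶠ m in (hyperfilter ℕ : Filter ℕ), ∀ f ∈ t, δ / 2 < dist (z.1 m) ((g f).1 m) := by
      refine (eventually_all_finite htf).2 fun f hf => ?_
      refine (tendsto_dist z (g f)).eventually (lt_mem_nhds ?_)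
      rw [hg f]
      by_contra! hlt
      have hzK : SeparationQuotient.mk z ∈ Metric.thickening δ K :=
        Metric.mem_thickening_iff.2 ⟨f, htK hf, by linarith⟩
      exact Set.disjoint_left.1 hdisj hzK (Metric.self_subset_thickening hδ _ hz)
    filter_upwards [hA z (Or.inr hz), hfar] with m h₁ h₂
    refine ⟨h₁, fun h => ?_⟩
    simp only [M, Set.mem_iUnion, exists_prop] at h
    obtain ⟨f, hf, hzf⟩ := h
    exact (h₂ f hf).not_gt hzf
  have key : ∀ {K : Set (UltraLim X)} {A : ∀ m, Set (X m).carrier} {a : ENNReal},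
      Covers A K → Tendsto (fun m => (X m).meas (A m)) (hyperfilter ℕ) (𝓝 a) → mass K ≤ a := by
    intro K A a hA ha
    refine le_of_forall_gt_imp_ge_of_dense fun b hb => mass_le hA ?_
    exact (ha.eventually (gt_mem_nhds hb)).mono fun m hm => hm.le
  obtain ⟨a, -, ha⟩ := isCompact_univ.exists_tendsto_hyperfilter
    (u := fun m => (X m).meas (A m ∩ M m)) (Eventually.of_forall fun _ => Set.mem_univ _)
  obtain ⟨b, -, hb⟩ := isCompact_univ.exists_tendsto_hyperfilter
    (u := fun m => (X m).meas (A m \ M m)) (Eventually.of_forall fun _ => Set.mem_univ _)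
  refine (add_le_add (key hMK ha) (key hML hb)).trans (le_of_tendsto (ha.add hb) ?_)
  filter_upwards [hc] with m hm
  refine le_trans (measure_inter_add_sdiff (A m) ?_).le hm
  exact (isOpen_biUnion fun _ _ => Metric.isOpen_ball).measurableSet

lemma covers_closedBall {K : Set (UltraLim X)} {r r' : ℝ} (hr : r < r')
    (hK : K ⊆ Metric.closedBall (root X) r) :
    Covers (fun m => Metric.closedBall (X m).basepoint r') K := by
  intro z hz
  exact ((tendsto_dist_root z).eventually (gt_mem_nhds ((hK hz).trans_lt hr))).mono
    fun m hm => hm.le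

lemma IsCauchy.mass_ne_top (hX : IsCauchy X) {K : Set (UltraLim X)} (hK : IsCompact K) :
    mass K ≠ ⊤ := by
  obtain ⟨r, hr⟩ := hK.isBounded.subset_closedBall (root X)
  obtain ⟨c, hc, hle⟩ := hX.exists_meas_closedBall_le (r + 1)
  exact ((mass_le (covers_closedBall (lt_add_one r) hr) hle).trans_lt hc.lt_top).ne

/-- The content on the ultralimit induced by the measures of the terms of the sequence. -/
def IsCauchy.content (hX : IsCauchy X) : Content (UltraLim X) where
  toFun K := (mass (K : Set (UltraLim X))).toNNReal
  mono' K L h := ENNReal.toNNReal_mono (hX.mass_ne_top L.isCompact) (mass_mono h)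
  sup_disjoint' K L h _ hL := by
    rw [← ENNReal.toNNReal_add (hX.mass_ne_top K.isCompact) (hX.mass_ne_top L.isCompact)]
    exact congrArg _ (le_antisymm (mass_union_le _ _) (mass_add_le_of_disjoint K.isCompact hL h))
  sup_le' K L := by
    rw [← ENNReal.toNNReal_add (hX.mass_ne_top K.isCompact) (hX.mass_ne_top L.isCompact)]
    exact ENNReal.toNNReal_mono (ENNReal.add_ne_top.2
      ⟨hX.mass_ne_top K.isCompact, hX.mass_ne_top L.isCompact⟩) (mass_union_le _ _)

lemma IsCauchy.content_apply (hX : IsCauchy X) (K : TopologicalSpace.Compacts (UltraLim X)) :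
    hX.content K = mass (K : Set (UltraLim X)) :=
  ENNReal.coe_toNNReal (hX.mass_ne_top K.isCompact)

/-- The limit of an asymptotically Cauchy sequence of pmm spaces. -/
def IsCauchy.limit (hX : IsCauchy X) : PMM where
  carrier := UltraLim X
  metric := inferInstance
  basepoint := root X
  meas := hX.content.measure

lemma IsCauchy.mass_le_limit_meas (hX : IsCauchy X) {K : Set (UltraLim X)} (hK : IsCompact K) :
    mass K ≤ hX.limit.meas K := by
  let K' : TopologicalSpace.Compacts (UltraLim X) := ⟨K, hK⟩
  refine (hX.content_apply K').ge.trans ((hX.content.le_outerMeasure_compacts K').trans ?_)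
  exact le_toMeasure_apply _ hX.content.borel_le_caratheodory _

lemma IsCauchy.limit_meas_le_mass (hX : IsCauchy X) {B K : Set (UltraLim X)} (hK : IsCompact K)
    (hBK : B ⊆ interior K) : hX.limit.meas B ≤ mass K := by
  let K' : TopologicalSpace.Compacts (UltraLim X) := ⟨K, hK⟩
  refine (measure_mono hBK).trans (le_trans ?_ (hX.content_apply K').le)
  refine le_trans (le_of_eq ?_) (hX.content.outerMeasure_interior_compacts K')
  exact hX.content.measure_apply isOpen_interior.measurableSet

lemma IsCauchy.boundedlyCompact_limit (hX : IsCauchy X) : hX.limit.BoundedlyCompact := by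
  refine ⟨fun y r => hX.isCompact_closedBall y r, fun y r => ?_⟩
  refine ((hX.limit_meas_le_mass (hX.isCompact_closedBall y (r + 1)) ?_).trans_lt
    (hX.mass_ne_top (hX.isCompact_closedBall y (r + 1))).lt_top).ne
  exact (Metric.closedBall_subset_ball (lt_add_one r)).trans
    (interior_maximal Metric.ball_subset_closedBall Metric.isOpen_ball)

end UltraLim

namespace UltraLim

variable {X : ℕ → PMM} {𝒜 : PMM} {R : ∀ m, 𝒜.carrier → (X m).carrier → Prop} {r ρ ε : ℝ}

/-- The fattening of the limit relation by `3 * ε` on both sides. -/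
def fatRel (ε : ℝ) (R : ∀ m, 𝒜.carrier → (X m).carrier → Prop)
    (x : 𝒜.carrier) (y : UltraLim X) : Prop :=
  ∃ x' y', dist x x' ≤ 3 * ε ∧ limRel R x' y' ∧ dist y y' ≤ 3 * ε

lemma fatRel_of_limRel (hε : 0 < ε) {x : 𝒜.carrier} {y : UltraLim X} (h : limRel R x y) :
    fatRel ε R x y :=
  ⟨x, y, by simp [hε.le], h, by simp [hε.le]⟩

lemma fatRel_distortion
    (hR : ∀ᶠ m in (hyperfilter ℕ : Filter ℕ), 𝒜.IsApproxRel (X m) ρ ε (R m))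
    {x₁ x₂ : 𝒜.carrier} {y₁ y₂ : UltraLim X} (h₁ : fatRel ε R x₁ y₁) (h₂ : fatRel ε R x₂ y₂) :
    |dist x₁ x₂ - dist y₁ y₂| ≤ 13 * ε := by
  obtain ⟨x₁', y₁', hx₁, h₁, hy₁⟩ := h₁
  obtain ⟨x₂', y₂', hx₂, h₂, hy₂⟩ := h₂
  have hd := abs_le.1 (limRel_distortion hR h₁ h₂)
  have hx := abs_le.1 ((dist_dist_dist_le x₁ x₂ x₁' x₂').trans (add_le_add hx₁ hx₂))
  have hy := abs_le.1 ((dist_dist_dist_le y₁ y₂ y₁' y₂').trans (add_le_add hy₁ hy₂))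
  rw [abs_le]
  constructor <;> linarith

lemma IsCauchy.meas_le_limit_meas (hX : IsCauchy X) (h𝒜 : 𝒜.BoundedlyCompact)
    (hR : ∀ᶠ m in (hyperfilter ℕ : Filter ℕ), 𝒜.IsApproxRel (X m) ρ ε (R m)) (hε : 0 < ε)
    (hρ : r ≤ ρ) {A : Set 𝒜.carrier} (hA : A ⊆ Metric.closedBall 𝒜.basepoint r) :
    𝒜.meas A ≤ hX.limit.meas {y : UltraLim X | ∃ x ∈ A, fatRel ε R x y} + ENNReal.ofReal ε := by
  set K : Set (UltraLim X) := closure {y | ∃ x ∈ closure A, limRel R x y} with hKdef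
  have hK : IsCompact K := by
    refine (hX.isCompact_closedBall (root X) (r + ε)).of_isClosed_subset isClosed_closure
      (closure_minimal ?_ Metric.isClosed_closedBall)
    rintro y ⟨x, hx, hxy⟩
    have h₁ := abs_le.1 (limRel_distortion hR hxy (limRel_root hR))
    have h₂ : dist x 𝒜.basepoint ≤ r := closure_minimal hA Metric.isClosed_closedBall hx
    rw [Metric.mem_closedBall]
    linarith
  have hKA : K ⊆ {y : UltraLim X | ∃ x ∈ A, fatRel ε R x y} := by
    intro y hy
    obtain ⟨y', ⟨x', hx', hxy⟩, hyy⟩ := Metric.mem_closure_iff.1 hy ε hε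
    obtain ⟨x, hx, hxx⟩ := Metric.mem_closure_iff.1 hx' ε hε
    rw [dist_comm] at hxx
    exact ⟨x, hx, x', y', by linarith, hxy, by linarith⟩
  have hmass : 𝒜.meas A - ENNReal.ofReal ε ≤ mass K := by
    refine le_sInf ?_
    rintro c ⟨B, hB, hc⟩
    have hsub : ∀ᶠ m in (hyperfilter ℕ : Filter ℕ), {y | ∃ x ∈ A, R m x y} ⊆ B m := by
      by_contra hcon
      rw [← Ultrafilter.eventually_not] at hcon
      obtain ⟨z, hz⟩ := exists_bddSeq (X := X)
        (p := fun m y => y ∉ B m ∧ ∃ x, x ∈ A ∧ R m x y) (C := r + ε) <| by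
        filter_upwards [hcon, hR] with m hm hRm
        obtain ⟨y, ⟨x, hx, hxy⟩, hy⟩ := Set.not_subset.1 hm
        exact ⟨y, ⟨hy, x, hx, hxy⟩,
          (hRm.dist_right_le hxy).trans (add_le_add_left (hA hx) _)⟩
      obtain ⟨u, hu⟩ := (hz.mono fun m hm => hm.1.2).choice
      obtain ⟨x, hux, hx⟩ := exists_limRel_of_eventually h𝒜 hR z (hu.mono fun m hm => hm.2)
      have hzK : SeparationQuotient.mk z ∈ K :=
        subset_closure ⟨x, mem_closure_of_tendsto hux (hu.mono fun m hm => hm.1), hx⟩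
      obtain ⟨m, h₁, h₂⟩ := ((hB z hzK).and hz).exists
      exact h₂.1.1 h₁
    obtain ⟨m, h₁, h₂, h₃⟩ := (hsub.and (hc.and hR)).exists
    rw [tsub_le_iff_right]
    refine (h₃.meas_le_right A (hA.trans (Metric.closedBall_subset_closedBall hρ))).trans ?_
    exact add_le_add_left ((measure_mono h₁).trans h₂) _
  rw [← tsub_le_iff_right]
  exact hmass.trans ((hX.mass_le_limit_meas hK).trans (measure_mono hKA))

lemma IsCauchy.limit_meas_le_meas (hX : IsCauchy X) (h𝒜 : 𝒜.BoundedlyCompact)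
    (hR : ∀ᶠ m in (hyperfilter ℕ : Filter ℕ), 𝒜.IsApproxRel (X m) ρ ε (R m)) (hε : 0 < ε)
    (hρ : r + 3 * ε ≤ ρ) {B : Set (UltraLim X)} (hB : B ⊆ Metric.closedBall (root X) r) :
    hX.limit.meas B ≤ 𝒜.meas {x | ∃ y ∈ B, fatRel ε R x y} + ENNReal.ofReal ε := by
  set W : Set 𝒜.carrier := {x | ∃ y ∈ B, fatRel ε R x y}
  have hnear : ∀ y ∈ Metric.cthickening ε B, ∃ b ∈ B, dist y b < 2 * ε := fun y hy =>
    Metric.mem_thickening_iff.1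
      (Metric.cthickening_subset_thickening' (by linarith) (by linarith) B hy)
  have hball : Metric.cthickening ε B ⊆ Metric.closedBall (root X) (r + 2 * ε) := by
    intro y hy
    obtain ⟨b, hb, hyb⟩ := hnear y hy
    have h₁ : dist b (root X) ≤ r := hB hb
    have h₂ := dist_triangle y b (root X)
    rw [Metric.mem_closedBall]
    linarith
  refine (hX.limit_meas_le_mass (K := Metric.cthickening ε B)
    ((hX.isCompact_closedBall _ _).of_isClosed_subset Metric.isClosed_cthickening hball)
    ((Metric.self_subset_thickening hε B).trans (interior_maximal
      (Metric.thickening_subset_cthickening ε B) Metric.isOpen_thickening))).trans ?_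
  refine mass_le (A := fun m => {y | y ∈ Metric.closedBall (X m).basepoint (r + 3 * ε) ∧
    ∀ x, R m x y → x ∈ W}) ?_ ?_
  · intro z hz
    refine (covers_closedBall (by linarith) hball z hz).and ?_
    by_contra hcon
    rw [← Ultrafilter.eventually_not] at hcon
    obtain ⟨u, hu⟩ := (hcon.mono fun m hm => not_forall.1 hm).choice
    simp only [Classical.not_imp] at hu
    obtain ⟨x, hux, hx⟩ := exists_limRel_of_eventually h𝒜 hR z (hu.mono fun m hm => hm.1)
    obtain ⟨b, hb, hzb⟩ := hnear _ hz
    obtain ⟨m, h₁, h₂⟩ := (hu.and (hux.eventually (Metric.ball_mem_nhds x hε))).exists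
    rw [dist_comm] at hzb
    exact h₁.2 ⟨b, hb, x, _, by linarith, hx, by linarith⟩
  · filter_upwards [hR] with m hm
    refine (hm.meas_le_left _ fun y hy =>
      Metric.closedBall_subset_closedBall hρ hy.1).trans (add_le_add_left (measure_mono ?_) _)
    rintro x ⟨y, hy, hxy⟩
    exact hy.2 x hxy

lemma IsCauchy.exists_approx_limit (hX : IsCauchy X) (r : ℝ) {ε : ℝ} (hε : 0 < ε) :
    ∃ N, ∀ n ≥ N, (X n).Approx hX.limit r ε := by
  have he : 0 < ε / 13 := by positivity
  obtain ⟨N, hN⟩ := hX.exists_rel (r + 3 * (ε / 13)) he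
  refine ⟨N, fun n hn => ?_⟩
  obtain ⟨R, hR⟩ := hN n hn
  have hle : ENNReal.ofReal (ε / 13) ≤ ENNReal.ofReal ε :=
    ENNReal.ofReal_le_ofReal (by linarith)
  refine ⟨fun x (y : UltraLim X) => fatRel (ε / 13) R x y, ?_, ?_, ?_, ?_, ?_, ?_⟩
  · exact fatRel_of_limRel he (limRel_root hR)
  · intro x x' y y' h h'
    exact (fatRel_distortion hR h h').trans (by linarith)
  · intro x hx
    obtain ⟨y, hy⟩ := exists_limRel_right hR (x := x) (by linarith)
    exact ⟨y, fatRel_of_limRel he hy⟩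
  · intro y hy
    have hy' : dist (y : UltraLim X) (root X) ≤ r := hy
    obtain ⟨x, hx⟩ := exists_limRel_left (hX.1 n) hR (hy'.trans_lt (by linarith))
    exact ⟨x, fatRel_of_limRel he hx⟩
  · intro A hA
    exact (hX.meas_le_limit_meas (hX.1 n) hR he (by linarith) hA).trans (add_le_add_right hle _)
  · intro B hB
    exact (hX.limit_meas_le_meas (hX.1 n) hR he le_rfl hB).trans (add_le_add_right hle _)

end UltraLim

lemma GHP_exists_limit (X : ℕ → PMM) (hX : ∀ n, (X n).BoundedlyCompact)
    (hcau : ∀ δ : ℝ, 0 < δ → ∃ N : ℕ, ∀ m ≥ N, ∀ n ≥ N, GHP (X m) (X n) < δ) :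
    ∃ 𝒴 : PMM, 𝒴.BoundedlyCompact ∧ Tendsto (fun n => GHP (X n) 𝒴) atTop (𝓝 0) := by
  have hC : UltraLim.IsCauchy X := by
    refine ⟨hX, fun r ε hε => ?_⟩
    have hs : 0 < max r 0 + 1 := by positivity
    set δ : ℝ := min (1 / (max r 0 + 1)) (min ε 1)
    have hδ : 0 < δ := by positivity
    obtain ⟨N, hN⟩ := hcau δ hδ
    refine ⟨N, fun m hm n hn => ?_⟩
    refine (approx_of_GHP_lt (hX m) (hX n) ((min_le_right _ _).trans (min_le_right _ _))
      (hN m hm n hn)).mono ?_ ((min_le_right _ _).trans (min_le_left _ _))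
    have h := (le_one_div hδ hs).1 (min_le_left _ _)
    linarith [le_max_left r 0]
  refine ⟨hC.limit, hC.boundedlyCompact_limit, Metric.tendsto_atTop.2 fun δ hδ => ?_⟩
  obtain ⟨r, η, -, hη, h⟩ := exists_GHP_lt_of_approx hC.boundedlyCompact_limit hδ
  obtain ⟨N, hN⟩ := hC.exists_approx_limit r hη
  refine ⟨N, fun n hn => ?_⟩
  rw [Real.dist_eq, sub_zero, abs_of_nonneg (GHP_nonneg _ _)]
  exact h _ (hX n) (hN n hn)

lemma GHP_comm (𝒳 𝒴 : PMM) : GHP 𝒳 𝒴 = GHP 𝒴 𝒳 := by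
  simp only [GHP, max_comm]

/-- The data of a pmm space with carrier `Fin k`: the distances, the weights and the root. -/
abbrev FinParam (k : ℕ) : Type :=
  {p : (Fin k → Fin k → ℝ) × (Fin k → NNReal) × Fin k //
    (∀ i, p.1 i i = 0) ∧ (∀ i j, p.1 i j = p.1 j i) ∧
      (∀ i j l, p.1 i l ≤ p.1 i j + p.1 j l) ∧ ∀ i j, p.1 i j = 0 → i = j}

namespace FinParam

variable {k : ℕ}

instance : SecondCountableTopology (FinParam k) :=
  TopologicalSpace.secondCountableTopology_induced _ _ Subtype.val

/-- The carrier of the finite space described by a parameter. -/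
def Carrier (_ : FinParam k) : Type := Fin k

instance (p : FinParam k) : Fintype p.Carrier := inferInstanceAs (Fintype (Fin k))

instance (p : FinParam k) : MetricSpace p.Carrier where
  dist := p.1.1
  dist_self := p.2.1
  dist_comm := p.2.2.1
  dist_triangle := p.2.2.2.1
  eq_of_dist_eq_zero := fun {i j} => p.2.2.2.2 i j

instance (p : FinParam k) : MeasurableSpace p.Carrier := borel _

instance (p : FinParam k) : BorelSpace p.Carrier := ⟨rfl⟩

/-- The finite pmm space described by a parameter. -/
def toPMM (p : FinParam k) : PMM where
  carrier := p.Carrier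
  metric := inferInstance
  basepoint := p.1.2.2
  meas := ∑ i : p.Carrier, (p.1.2.1 i : ENNReal) • Measure.dirac i

instance (p : FinParam k) : Finite p.toPMM.carrier := inferInstanceAs (Finite p.Carrier)

open Classical in
lemma toPMM_meas_apply (p : FinParam k) (B : Set (Fin k)) :
    p.toPMM.meas B = ∑ i with i ∈ B, (p.1.2.1 i : ENNReal) := by
  have h : ∀ (w : p.Carrier → NNReal) (B : Set p.Carrier),
      (∑ i, (w i : ENNReal) • Measure.dirac i : Measure p.Carrier) B =
        ∑ i with i ∈ B, (w i : ENNReal) := by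
    intro w B
    rw [Measure.finsetSum_apply, Finset.sum_filter]
    refine Finset.sum_congr rfl fun i _ => ?_
    rw [Measure.smul_apply, Measure.dirac_apply, Set.indicator_apply]
    split_ifs <;> simp
  exact h p.1.2.1 B

lemma boundedlyCompact_toPMM (p : FinParam k) : p.toPMM.BoundedlyCompact := by
  classical
  refine ⟨fun x r => (Set.toFinite _).isCompact, fun x r => ?_⟩
  refine (toPMM_meas_apply p _).trans_ne ?_
  exact ENNReal.sum_ne_top.2 fun i _ => ENNReal.coe_ne_top

/-- A finite net of a ball, together with a partition of the ball into small cells around the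
points of the net, approximates the space. -/
lemma approx_of_net {𝒳 : PMM} {p : FinParam k} {x : Fin k → 𝒳.carrier}
    {C : Fin k → Set 𝒳.carrier} {r ε : ℝ} (hε : 0 < ε)
    (hroot : x p.1.2.2 = 𝒳.basepoint)
    (hC : Metric.closedBall 𝒳.basepoint r ⊆ ⋃ i, C i)
    (hCm : ∀ i, MeasurableSet (C i)) (hCd : Pairwise (Function.onFun Disjoint C))
    (hCx : ∀ i, C i ⊆ Metric.ball (x i) ε)
    (hd : ∀ i j, |dist (x i) (x j) - p.1.1 i j| ≤ ε)
    (hw₁ : ∑ i, (𝒳.meas (C i) - p.1.2.1 i) ≤ ENNReal.ofReal ε)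
    (hw₂ : ∑ i, ((p.1.2.1 i : ENNReal) - 𝒳.meas (C i)) ≤ ENNReal.ofReal ε) :
    p.toPMM.Approx 𝒳 r (3 * ε) := by
  classical
  have hle : ENNReal.ofReal ε ≤ ENNReal.ofReal (3 * ε) :=
    ENNReal.ofReal_le_ofReal (by linarith)
  have hsum : ∀ (S : Finset (Fin k)) (a b : Fin k → ENNReal),
      ∑ i, (a i - b i) ≤ ENNReal.ofReal ε →
        ∑ i ∈ S, a i ≤ ∑ i ∈ S, b i + ENNReal.ofReal (3 * ε) := by
    intro S a b h
    calc ∑ i ∈ S, a i ≤ ∑ i ∈ S, (b i + (a i - b i)) :=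
          Finset.sum_le_sum fun i _ => le_add_tsub
      _ = ∑ i ∈ S, b i + ∑ i ∈ S, (a i - b i) := Finset.sum_add_distrib
      _ ≤ _ := add_le_add_right ((Finset.sum_le_univ_sum_of_nonneg fun _ => zero_le).trans
          (h.trans hle)) _
  refine ⟨fun (i : Fin k) y => dist y (x i) < ε, ?_, ?_, ?_, ?_, ?_, ?_⟩
  · change dist 𝒳.basepoint (x p.1.2.2) < ε
    rw [hroot, dist_self]
    exact hε
  · intro i j y z hy hz
    have h₁ := abs_le.1 (hd i j)
    have h₂ := abs_le.1 ((dist_dist_dist_le y z (x i) (x j)).trans (add_le_add hy.le hz.le))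
    change |p.1.1 i j - dist y z| ≤ 3 * ε
    rw [abs_le]
    constructor <;> linarith
  · intro i _
    exact ⟨x i, by rw [dist_self]; exact hε⟩
  · intro y hy
    obtain ⟨i, hi⟩ := Set.mem_iUnion.1 (hC hy)
    exact ⟨i, hCx i hi⟩
  · intro A _
    refine (toPMM_meas_apply p A).le.trans ((hsum _ _ _ hw₂).trans (add_le_add_left ?_ _))
    rw [← measure_biUnion_finset (fun i _ j _ hij => hCd hij) fun i _ => hCm i]
    refine measure_mono (Set.iUnion₂_subset fun i hi y hy => ?_)
    exact ⟨i, (Finset.mem_filter.1 hi).2, hCx i hy⟩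
  · intro B hB
    set S : Set (Fin k) := {i | ∃ y ∈ B, dist y (x i) < ε}
    have hS : 𝒳.meas B ≤ ∑ i with i ∈ S, 𝒳.meas (C i) := by
      refine le_trans (measure_mono fun y hy => ?_) (measure_biUnion_finset_le _ _)
      obtain ⟨i, hi⟩ := Set.mem_iUnion.1 (hC (hB hy))
      exact Set.mem_biUnion (Finset.mem_coe.2
        (Finset.mem_filter.2 ⟨Finset.mem_univ i, y, hy, hCx i hi⟩)) hi
    exact hS.trans ((hsum _ _ _ hw₁).trans
      (add_le_add_left (toPMM_meas_apply p S).ge _))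

end FinParam

lemma PMM.BoundedlyCompact.exists_isOpen_approx {𝒳 : PMM} (h𝒳 : 𝒳.BoundedlyCompact) {r ε : ℝ}
    (hε : 0 < ε) : ∃ k, ∃ U : Set (FinParam k), IsOpen U ∧ U.Nonempty ∧
      ∀ p ∈ U, p.toPMM.Approx 𝒳 r (3 * ε) := by
  classical
  obtain ⟨t, -, htf, ht⟩ := (h𝒳.1 𝒳.basepoint r).finite_cover_balls hε
  obtain ⟨k, x, hx, hxr⟩ := (htf.insert 𝒳.basepoint).fin_param
  obtain ⟨i₀, hi₀⟩ : 𝒳.basepoint ∈ Set.range x := hxr ▸ Set.mem_insert _ _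
  let D : Fin k → Set 𝒳.carrier := fun i =>
    Metric.closedBall 𝒳.basepoint r ∩ Metric.ball (x i) ε
  let C : Fin k → Set 𝒳.carrier := disjointed D
  have hCD : ∀ i, C i ⊆ D i := disjointed_le D
  have hC : Metric.closedBall 𝒳.basepoint r ⊆ ⋃ i, C i := by
    rw [iUnion_disjointed]
    intro y hy
    have hyt := ht hy
    simp only [Set.mem_iUnion, exists_prop] at hyt
    obtain ⟨f, hf, hyf⟩ := hyt
    obtain ⟨i, rfl⟩ : f ∈ Set.range x := hxr ▸ Set.mem_insert_of_mem _ hf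
    exact Set.mem_iUnion.2 ⟨i, hy, hyf⟩
  have hCm : ∀ i, MeasurableSet (C i) := fun i =>
    disjointedRec (fun _ j h => h.diff (measurableSet_closedBall.inter measurableSet_ball))
      (measurableSet_closedBall.inter measurableSet_ball)
  have hfin : ∀ i, 𝒳.meas (C i) ≠ ⊤ := fun i =>
    ((measure_mono ((hCD i).trans Set.inter_subset_left)).trans_lt (h𝒳.2 _ r).lt_top).ne
  let w : Fin k → NNReal := fun i => (𝒳.meas (C i)).toNNReal
  have hw : ∀ i, (w i : ENNReal) = 𝒳.meas (C i) := fun i => ENNReal.coe_toNNReal (hfin i)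
  let p₀ : FinParam k := ⟨(fun i j => dist (x i) (x j), w, i₀), fun i => dist_self _,
    fun i j => dist_comm _ _, fun i j l => dist_triangle _ _ _,
    fun i j h => hx (dist_eq_zero.1 h)⟩
  let f₁ : FinParam k → ENNReal := fun p => ∑ i, ((w i : ENNReal) - p.1.2.1 i)
  let f₂ : FinParam k → ENNReal := fun p => ∑ i, ((p.1.2.1 i : ENNReal) - w i)
  have hf₁ : Continuous f₁ := by
    refine continuous_finsetSum _ fun i _ => ?_
    simp only [← ENNReal.coe_sub]
    exact ENNReal.continuous_coe.comp (by fun_prop)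
  have hf₂ : Continuous f₂ := by
    refine continuous_finsetSum _ fun i _ => ?_
    simp only [← ENNReal.coe_sub]
    exact ENNReal.continuous_coe.comp (by fun_prop)
  refine ⟨k, {p | p.1.2.2 = i₀} ∩ (⋂ i, ⋂ j, {p | |dist (x i) (x j) - p.1.1 i j| < ε}) ∩
    {p | f₁ p < ENNReal.ofReal ε} ∩ {p | f₂ p < ENNReal.ofReal ε}, ?_, ⟨p₀, ?_⟩, ?_⟩
  · refine (((isOpen_discrete {i₀}).preimage (f := fun p : FinParam k => p.1.2.2)
      (by fun_prop)).inter ?_).inter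
      (isOpen_lt hf₁ continuous_const) |>.inter (isOpen_lt hf₂ continuous_const)
    exact isOpen_iInter_of_finite fun i => isOpen_iInter_of_finite fun j =>
      isOpen_lt (by fun_prop) continuous_const
  · simp [p₀, f₁, f₂, hε]
  · rintro p ⟨⟨⟨hp₁, hp₂⟩, hp₃⟩, hp₄⟩
    simp only [Set.mem_iInter, Set.mem_ofPred_eq] at hp₁ hp₂ hp₃ hp₄
    refine FinParam.approx_of_net (x := x) (C := C) hε (by rw [hp₁, hi₀]) hC hCm
      (disjoint_disjointed D) (fun i => (hCD i).trans Set.inter_subset_right)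
      (fun i j => (hp₂ i j).le) ?_ ?_
    · simpa only [f₁, hw] using hp₃.le
    · simpa only [f₂, hw] using hp₄.le

lemma GHP_exists_dense_seq : ∃ D : ℕ → PMM, (∀ n, (D n).BoundedlyCompact) ∧
    ∀ 𝒳 : PMM, 𝒳.BoundedlyCompact → ∀ δ : ℝ, 0 < δ → ∃ n : ℕ, GHP 𝒳 (D n) < δ := by
  have : Nonempty (Σ k, FinParam k) :=
    ⟨1, (0, 0, 0), fun _ => rfl, fun _ _ => rfl, fun _ _ _ => by simp,
      fun _ _ _ => Subsingleton.elim _ _⟩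
  let q := TopologicalSpace.denseSeq (Σ k, FinParam k)
  refine ⟨fun n => (q n).2.toPMM, fun n => (q n).2.boundedlyCompact_toPMM,
    fun 𝒳 h𝒳 δ hδ => ?_⟩
  obtain ⟨r, η, -, hη, h⟩ := exists_GHP_lt_of_approx h𝒳 hδ
  obtain ⟨k, U, hU, hUne, hUr⟩ := h𝒳.exists_isOpen_approx (r := r) (ε := η / 3) (by positivity)
  obtain ⟨n, p, hp, hpn⟩ := (TopologicalSpace.denseRange_denseSeq (Σ k, FinParam k)).exists_mem_open
    (isOpenMap_sigmaMk (i := k) _ hU) (hUne.image _)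
  refine ⟨n, ?_⟩
  have hqn : (⟨k, p⟩ : Σ k, FinParam k) = q n := hpn
  change GHP 𝒳 (q n).2.toPMM < δ
  rw [GHP_comm, ← hqn]
  have hap := hUr p hp
  rw [mul_div_cancel₀ η three_ne_zero] at hap
  exact h _ p.boundedlyCompact_toPMM hap

/-- Under the Gromov-Hausdorff-Prokhorov metric, the space of (GHP-isometry classes of)
boundedly compact pmm spaces is complete and separable: every Cauchy sequence of boundedly
compact pmm spaces converges to a boundedly compact pmm space, and there is a countable
family of boundedly compact pmm spaces which is dense. -/
theorem GHP_complete_separable :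
    (∀ 𝒳 : ℕ → PMM, (∀ n, (𝒳 n).BoundedlyCompact) →
      (∀ δ : ℝ, 0 < δ → ∃ N : ℕ, ∀ m ≥ N, ∀ n ≥ N, GHP (𝒳 m) (𝒳 n) < δ) →
      ∃ 𝒴 : PMM, 𝒴.BoundedlyCompact ∧ Tendsto (fun n => GHP (𝒳 n) 𝒴) atTop (𝓝 0)) ∧
    (∃ D : ℕ → PMM, (∀ n, (D n).BoundedlyCompact) ∧
      ∀ 𝒳 : PMM, 𝒳.BoundedlyCompact → ∀ δ : ℝ, 0 < δ → ∃ n : ℕ, GHP 𝒳 (D n) < δ) :=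
  ⟨GHP_exists_limit, GHP_exists_dense_seq⟩

end
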